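/- (Nash's equilibrium theorem, Theorem 1.) For every finite n-player game given by pure payoff functions u i, there exists an equilibrium strategy profile: a profile s* with s* i ∈ 𝔖_i for every player i, such that for every player i and every strategy σ ∈ 𝔖_i one has ℘ i s* ≥ ℘ i (Function.update s* i σ). That is, no player can increase his expected payoff by unilaterally changing his strategy. -/

import Mathlib

open Finset

/-- The mixed (expected) payoff to player `i` at the strategy profile `s`:
`℘ i s = ∑ v, (∏ j, s j (v j)) * u i v`. -/
noncomputable def mixedPayoff {n : ℕ} {m : Fin n → ℕ}
    (u : Fin n → ((i : Fin n) → Fin (m i)) → ℝ)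
    (i : Fin n) (s : (i : Fin n) → Fin (m i) → ℝ) : ℝ :=
  ∑ v : (i : Fin n) → Fin (m i), (∏ j, s j (v j)) * u i v

lemma bijective_of_det_ne {E : Type*} [NormedAddCommGroup E] [NormedSpace ℝ E]
    [FiniteDimensional ℝ E] {A : E →L[ℝ] E} (h : A.det ≠ 0) :
    Function.Bijective (A : E →ₗ[ℝ] E) := by
  rw [← Module.End.isUnit_iff, LinearMap.isUnit_iff_isUnit_det]
  exact isUnit_iff_ne_zero.2 h

/-- `det (1 + t A)` at `t = 1` is a fixed linear combination of its values at given nodes. -/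
lemma det_interp {E : Type*} [NormedAddCommGroup E] [NormedSpace ℝ E] [FiniteDimensional ℝ E]
    (δ : ℝ) (hδ : 0 < δ) :
    ∃ (N : ℕ) (v w : ℕ → ℝ), (∀ j ∈ Finset.range N, 0 < v j ∧ v j < δ) ∧
      (∑ j ∈ Finset.range N, w j = 1) ∧
      ∀ A : E →L[ℝ] E, (1 + A).det = ∑ j ∈ Finset.range N, w j * (1 + v j • A).det := by
  set d := Module.finrank ℝ E
  let v : ℕ → ℝ := fun j => δ / (j + 2)
  have hvinj : Set.InjOn v (Finset.range (d + 1)) := by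
    intro a _ b _ h
    simp only [v] at h
    have ha : (a : ℝ) + 2 ≠ 0 := by positivity
    have hb : (b : ℝ) + 2 ≠ 0 := by positivity
    field_simp at h
    have : (a : ℝ) = b := by linarith
    exact_mod_cast this
  refine ⟨d + 1, v, fun j => (Lagrange.basis (Finset.range (d + 1)) v j).eval 1, ?_, ?_, ?_⟩
  · intro j _
    refine ⟨by positivity, ?_⟩
    simp only [v]
    rw [div_lt_iff₀ (by positivity)]
    nlinarith [(Nat.cast_nonneg j : (0 : ℝ) ≤ j)]
  · rw [← Polynomial.eval_finsetSum, Lagrange.sum_basis hvinj (by simp)]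
    simp
  · intro A
    let b := Module.finBasis ℝ E
    let M := LinearMap.toMatrix b b (A : E →ₗ[ℝ] E)
    let p : Polynomial ℝ := Matrix.det ((Polynomial.X : Polynomial ℝ) • M.map Polynomial.C
      + (1 : Matrix (Fin d) (Fin d) ℝ).map Polynomial.C)
    have hp : ∀ t : ℝ, p.eval t = (1 + t • A).det := by
      intro t
      have h1 : (1 + t • A).det = Matrix.det (t • M + 1) := by
        change LinearMap.det ((1 + t • A : E →L[ℝ] E) : E →ₗ[ℝ] E) = _
        rw [← LinearMap.det_toMatrix b]
        congr 1
        rw [ContinuousLinearMap.toLinearMap_add, ContinuousLinearMap.toLinearMap_smul, map_add, map_smul, add_comm]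
        congr 1
        exact LinearMap.toMatrix_one b
      rw [h1]
      simp only [p]
      rw [← Polynomial.coe_evalRingHom, RingHom.map_det]
      congr 1
      ext a b
      by_cases hab : a = b
      · subst hab
        simp [Matrix.one_apply]
        ring
      · simp [Matrix.one_apply, if_neg hab]
        ring
    have hdeg : p.degree < (Finset.range (d + 1)).card := by
      refine lt_of_le_of_lt Polynomial.degree_le_natDegree ?_
      have := Polynomial.natDegree_det_X_add_C_le M 1
      simp only [Fintype.card_fin] at this
      simp only [card_range]
      exact_mod_cast Nat.lt_succ_of_le this
    have h := Lagrange.eq_interpolate hvinj hdeg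
    have h2 := congrArg (Polynomial.eval 1) h
    rw [hp, one_smul, Lagrange.interpolate_apply, Polynomial.eval_finsetSum] at h2
    rw [h2]
    refine Finset.sum_congr rfl fun j _ => ?_
    rw [Polynomial.eval_mul, Polynomial.eval_C, hp, mul_comm]

open Metric MeasureTheory in
lemma no_retraction {E : Type*} [NormedAddCommGroup E] [InnerProductSpace ℝ E]
    [FiniteDimensional ℝ E] [MeasurableSpace E] [BorelSpace E] (R : ℝ) (hR : 0 < R)
    (f : E → E) (hf : ContDiff ℝ 1 f) (hfn : ∀ x, ‖f x‖ = R)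
    (hfs : ∀ x, ‖x‖ = R → f x = x) : False := by
  have : CompleteSpace E := FiniteDimensional.complete ℝ E
  let μ : Measure E := Measure.addHaar
  let g : E → E := fun x => f x - x
  have hg : ContDiff ℝ 1 g := hf.sub contDiff_id
  have hgd : ∀ x, HasFDerivAt g (fderiv ℝ g x) x := fun x =>
    ((hg.differentiable (by norm_num)) x).hasFDerivAt
  have hgc : Continuous (fderiv ℝ g) := hg.continuous_fderiv (by norm_num)
  obtain ⟨C, hC⟩ := (isCompact_closedBall (0 : E) R).exists_bound_of_continuousOn
    hgc.continuousOn
  let C' : ℝ := max C 1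
  have hC' : ∀ x ∈ closedBall (0 : E) R, ‖fderiv ℝ g x‖ ≤ C' := fun x hx =>
    (hC x hx).trans (le_max_left _ _)
  have hC1 : 1 ≤ C' := le_max_right _ _
  have hlip : ∀ x ∈ closedBall (0 : E) R, ∀ y ∈ closedBall (0 : E) R,
      ‖g y - g x‖ ≤ C' * ‖y - x‖ := fun x hx y hy =>
    (convex_closedBall (0 : E) R).norm_image_sub_le_of_norm_fderiv_le
      (fun z _ => (hgd z).differentiableAt) hC' hx hy
  -- positivity of the determinant near the identity
  obtain ⟨η, hη, hdet⟩ : ∃ η > 0, ∀ A : E →L[ℝ] E, ‖A‖ < η → 0 < (1 + A).det := by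
    have hc : Continuous fun A : E →L[ℝ] E => (1 + A).det :=
      ContinuousLinearMap.continuous_det.comp (continuous_const.add continuous_id)
    have h0 : (0 : ℝ) < (1 + (0 : E →L[ℝ] E)).det := by
      rw [add_zero]
      change (0 : ℝ) < LinearMap.det ((1 : E →L[ℝ] E) : E →ₗ[ℝ] E)
      have : ((1 : E →L[ℝ] E) : E →ₗ[ℝ] E) = LinearMap.id := rfl
      rw [this, LinearMap.det_id]; norm_num
    have := (hc.continuousAt (x := 0)).eventually (lt_mem_nhds h0)
    obtain ⟨η, hη, h⟩ := Metric.eventually_nhds_iff.1 this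
    exact ⟨η, hη, fun A hA => h (by simpa using hA)⟩
  let δ : ℝ := min (1 / C') (η / C')
  have hC0 : 0 < C' := by linarith
  have hδ : 0 < δ := lt_min (by positivity) (by positivity)
  have hcont : ∀ t : ℝ, Continuous fun x => (1 + t • fderiv ℝ g x).det := fun t =>
    ContinuousLinearMap.continuous_det.comp (continuous_const.add (hgc.const_smul t))
  have hint : ∀ t : ℝ, IntegrableOn (fun x => (1 + t • fderiv ℝ g x).det) (ball 0 R) μ := fun t =>
    ((hcont t).continuousOn.integrableOn_compact (isCompact_closedBall 0 R)).mono_set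
      ball_subset_closedBall
  -- the key: volume preserved for small t
  have key : ∀ t : ℝ, 0 < t → t < δ →
      ∫ x in ball (0 : E) R, (1 + t • fderiv ℝ g x).det ∂μ = (μ (ball (0 : E) R)).toReal := by
    intro t ht0 htδ
    have ht1 : t * C' < 1 := by
      have := htδ.trans_le (min_le_left _ _)
      rwa [lt_div_iff₀ hC0] at this
    have ht2 : t * C' < η := by
      have := htδ.trans_le (min_le_right _ _)
      rwa [lt_div_iff₀ hC0] at this
    have ht3 : t < 1 := by nlinarith
    let ft : E → E := fun x => x + t • g x
    have hft : ContDiff ℝ 1 ft := contDiff_id.add (hg.const_smul t)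
    have hftd : ∀ x, HasFDerivAt ft (1 + t • fderiv ℝ g x) x := fun x =>
      (hasFDerivAt_id x).add ((hgd x).const_smul t)
    have hpos : ∀ x ∈ closedBall (0 : E) R, 0 < (1 + t • fderiv ℝ g x).det := by
      intro x hx
      apply hdet
      rw [norm_smul, Real.norm_of_nonneg ht0.le]
      exact (mul_le_mul_of_nonneg_left (hC' x hx) ht0.le).trans_lt ht2
    have hinj : Set.InjOn ft (closedBall (0 : E) R) := by
      intro x hx y hy h
      by_contra hne
      have h1 : y - x = - (t • (g y - g x)) := by
        simp only [ft] at h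
        rw [smul_sub]
        have : y = x + t • g x - t • g y := by rw [h]; abel
        rw [eq_comm] at this
        nth_rewrite 1 [← this]; abel
      have h2 : ‖y - x‖ ≤ t * (C' * ‖y - x‖) := by
        calc ‖y - x‖ = t * ‖g y - g x‖ := by
              rw [h1, norm_neg, norm_smul, Real.norm_of_nonneg ht0.le]
          _ ≤ _ := mul_le_mul_of_nonneg_left (hlip x hx y hy) ht0.le
      have h3 : 0 < ‖y - x‖ := norm_pos_iff.2 (sub_ne_zero.2 (Ne.symm hne))
      nlinarith
    have hmaps : ∀ x ∈ closedBall (0 : E) R, ft x ∈ closedBall (0 : E) R := by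
      intro x hx
      have : ft x = (1 - t) • x + t • f x := by simp only [ft, g]; module
      rw [this]
      exact (convex_closedBall (0 : E) R) hx (by simp [hfn]) (by linarith) ht0.le (by ring)
    have hsph : ∀ x, ‖x‖ = R → ft x = x := by
      intro x hx; simp [ft, g, hfs x hx]
    have hmapsU : ∀ x ∈ ball (0 : E) R, ft x ∈ ball (0 : E) R := by
      intro x hx
      have h1 := hmaps x (ball_subset_closedBall hx)
      rw [mem_closedBall_zero_iff] at h1
      rw [mem_ball_zero_iff] at hx ⊢
      refine lt_of_le_of_ne h1 fun h => ?_
      have h2 := hsph _ h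
      have h3 := hinj (mem_closedBall_zero_iff.2 h1) (mem_closedBall_zero_iff.2 hx.le) h2
      rw [h3] at h
      linarith
    have hopen : IsOpen (ft '' ball (0 : E) R) := by
      rw [isOpen_iff_mem_nhds]
      rintro _ ⟨x, hx, rfl⟩
      have hs : HasStrictFDerivAt ft (1 + t • fderiv ℝ g x) x :=
        hft.contDiffAt.hasStrictFDerivAt' (hftd x) (by norm_num)
      have hsurj : ((1 + t • fderiv ℝ g x : E →L[ℝ] E)).range = ⊤ := by
        have := (hpos x (ball_subset_closedBall hx)).ne'
        exact LinearMap.range_eq_top.2 (bijective_of_det_ne this).2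
      rw [← hs.map_nhds_eq_of_surj hsurj]
      exact Filter.image_mem_map (isOpen_ball.mem_nhds hx)
    have himg : ft '' ball (0 : E) R = ball (0 : E) R := by
      apply Set.Subset.antisymm
      · rintro _ ⟨x, hx, rfl⟩; exact hmapsU x hx
      · refine (convex_ball (0 : E) R).isPreconnected.subset_of_closure_inter_subset hopen ?_ ?_
        · exact ⟨ft 0, hmapsU 0 (mem_ball_self hR), 0, mem_ball_self hR, rfl⟩
        · rintro y ⟨hy, hyU⟩
          have hcl : IsClosed (ft '' closedBall (0 : E) R) :=
            ((isCompact_closedBall (0 : E) R).image hft.continuous).isClosed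
          obtain ⟨x, hx, rfl⟩ := closure_minimal (Set.image_mono ball_subset_closedBall) hcl hy
          refine ⟨x, ?_, rfl⟩
          rw [mem_closedBall_zero_iff] at hx
          rw [mem_ball_zero_iff] at hyU ⊢
          refine lt_of_le_of_ne hx fun h => ?_
          rw [hsph x h] at hyU
          linarith
    have hcv := lintegral_abs_det_fderiv_eq_addHaar_image μ (measurableSet_ball (x := (0 : E)) (ε := R))
      (fun x _ => (hftd x).hasFDerivWithinAt) (hinj.mono ball_subset_closedBall)
    rw [himg] at hcv
    rw [← hcv, integral_eq_lintegral_of_nonneg_ae]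
    · congr 1
      refine setLIntegral_congr_fun measurableSet_ball fun x hx => ?_
      rw [abs_of_pos (hpos x (ball_subset_closedBall hx))]
    · exact (ae_restrict_iff' measurableSet_ball).2
        (Filter.Eventually.of_forall fun x hx => (hpos x (ball_subset_closedBall hx)).le)
    · exact (hcont t).aestronglyMeasurable
  obtain ⟨N, v, w, hv, hw, hA⟩ := det_interp (E := E) δ hδ
  have h1 : ∫ x in ball (0 : E) R, (1 + fderiv ℝ g x).det ∂μ = (μ (ball (0 : E) R)).toReal := by
    rw [integral_congr_ae (Filter.Eventually.of_forall fun x => hA (fderiv ℝ g x))]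
    rw [integral_finsetSum _ fun j _ => (hint (v j)).const_mul _]
    simp_rw [integral_const_mul]
    rw [Finset.sum_congr rfl fun j hj => by rw [key (v j) (hv j hj).1 (hv j hj).2],
      ← Finset.sum_mul, hw, one_mul]
  have h2 : ∀ x, (1 + fderiv ℝ g x).det = 0 := by
    intro x
    by_contra hne
    have hfd : HasFDerivAt f (1 + fderiv ℝ g x) x := by
      have := (hasFDerivAt_id x).add (hgd x)
      refine this.congr_of_eventuallyEq (Filter.Eventually.of_forall fun y => ?_)
      simp [g]
    have hin := hfd.inner ℝ hfd
    have hconst : (fun y => inner ℝ (f y) (f y)) = fun _ => R ^ 2 := by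
      funext y; rw [real_inner_self_eq_norm_sq, hfn]
    rw [hconst] at hin
    have h0 := hin.unique (hasFDerivAt_const _ _)
    obtain ⟨z, hz⟩ := (bijective_of_det_ne hne).2 (f x)
    have hz' : (1 + fderiv ℝ g x) z = f x := hz
    have h3 := congrArg (fun L => L z) h0
    simp only [ContinuousLinearMap.comp_apply, fderivInnerCLM_apply,
      ContinuousLinearMap.prod_apply, hz', real_inner_self_eq_norm_sq, hfn] at h3
    simp at h3
    exact hR.ne' h3
  simp_rw [h2] at h1
  simp only [integral_zero] at h1
  have h3 : 0 < (μ (ball (0 : E) R)).toReal :=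
    ENNReal.toReal_pos (measure_ball_pos μ _ hR).ne' measure_ball_lt_top.ne
  linarith

open Metric in
lemma bounded_fixed_point {E : Type*} [NormedAddCommGroup E] [InnerProductSpace ℝ E]
    [FiniteDimensional ℝ E] (F : E → E) (hF : Continuous F)
    (R : ℝ) (hFR : ∀ x, ‖F x‖ ≤ R) : ∃ x, F x = x := by
  borelize E
  by_contra! hne
  have hR0 : 0 ≤ R := (norm_nonneg _).trans (hFR 0)
  obtain ⟨G, hG⟩ := exists_contMDiffMap_forall_mem_convex_of_local_const (n := 1)
    (modelWithCornersSelf ℝ E) (t := fun x => ball (F x) (min 1 ‖x - F x‖))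
    (fun x => convex_ball _ _) (by
      intro x
      refine ⟨F x, ?_⟩
      have hc : Continuous fun y => min 1 ‖y - F y‖ - dist (F x) (F y) := by fun_prop
      have h0 : 0 < min 1 ‖x - F x‖ - dist (F x) (F x) := by
        rw [dist_self, sub_zero]
        exact lt_min one_pos (norm_pos_iff.2 (sub_ne_zero.2 (hne x).symm))
      filter_upwards [hc.continuousAt.eventually (lt_mem_nhds h0)] with y hy
      rw [mem_ball]; linarith)
  have hGs : ContDiff ℝ 1 G := G.contMDiff.contDiff
  let φ : ContDiffBump (0 : E) := ⟨R + 1, R + 2, by linarith, by linarith⟩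
  let h : E → E := fun x => x - φ x • G x
  have hh : ContDiff ℝ 1 h := contDiff_id.sub (φ.contDiff.smul hGs)
  have hh0 : ∀ x, h x ≠ 0 := by
    intro x hx
    have hd := hG x
    rw [mem_ball, lt_min_iff, dist_eq_norm] at hd
    have hx' : x = φ x • G x := sub_eq_zero.1 hx
    by_cases hxR : ‖x‖ ≤ R + 1
    · have h1 : φ x = 1 := φ.one_of_mem_closedBall (by simpa using hxR)
      rw [h1, one_smul] at hx'
      rw [← hx'] at hd
      exact lt_irrefl _ hd.2
    · have h1 : ‖x‖ ≤ ‖G x‖ := by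
        conv_lhs => rw [hx']
        rw [norm_smul, Real.norm_of_nonneg φ.nonneg]
        exact mul_le_of_le_one_left (norm_nonneg _) φ.le_one
      have h2 : ‖G x‖ ≤ ‖G x - F x‖ + ‖F x‖ := by
        simpa using norm_add_le (G x - F x) (F x)
      linarith [hd.1, hFR x]
  refine no_retraction (R + 2) (by linarith) (fun x => ((R + 2) * ‖h x‖⁻¹) • h x) ?_ ?_ ?_
  · exact (contDiff_const.mul ((hh.norm ℝ hh0).inv fun x => norm_ne_zero_iff.2 (hh0 x))).smul hh
  · intro x
    have := norm_ne_zero_iff.2 (hh0 x)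
    rw [norm_smul, norm_mul, norm_inv, norm_norm, Real.norm_of_nonneg (by linarith)]
    field_simp
  · intro x hx
    have h1 : φ x = 0 := φ.zero_of_le_dist (by simp [φ, hx])
    have h2 : h x = x := by simp [h, h1]
    simp only [h2, hx]
    rw [mul_inv_cancel₀ (by linarith), one_smul]

lemma payoff_update {n : ℕ} {m : Fin n → ℕ}
    (u : Fin n → ((i : Fin n) → Fin (m i)) → ℝ) (i : Fin n)
    (s : (i : Fin n) → Fin (m i) → ℝ) (σ : Fin (m i) → ℝ) :
    mixedPayoff u i (Function.update s i σ) =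
      ∑ j, σ j * mixedPayoff u i (Function.update s i (Pi.single j 1)) := by
  have key : ∀ (τ : Fin (m i) → ℝ) (v : (i : Fin n) → Fin (m i)),
      ∏ k, (Function.update s i τ) k (v k) = τ (v i) * ∏ k ∈ univ.erase i, s k (v k) := by
    intro τ v
    rw [← Finset.mul_prod_erase univ _ (mem_univ i), Function.update_self]
    congr 1
    refine Finset.prod_congr rfl fun k hk => ?_
    rw [Function.update_of_ne (Finset.ne_of_mem_erase hk)]
  simp only [mixedPayoff, key, Finset.mul_sum]
  rw [Finset.sum_comm]
  refine Finset.sum_congr rfl fun v _ => ?_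
  rw [Finset.sum_eq_single (v i)]
  · rw [Pi.single_eq_same]; ring
  · intro b _ hb
    rw [Pi.single_eq_of_ne (Ne.symm hb)]; ring
  · simp

lemma payoff_continuous {n : ℕ} {m : Fin n → ℕ}
    (u : Fin n → ((i : Fin n) → Fin (m i)) → ℝ) (i : Fin n) :
    Continuous (mixedPayoff u i) := by
  unfold mixedPayoff
  fun_prop

/-- A continuous retraction of `ℝ^k` onto the standard simplex. -/
noncomputable def simplexRetract {k : ℕ} (x : Fin k → ℝ) (j : Fin k) : ℝ :=
  (max (x j) 0 + max (1 - ∑ l, max (x l) 0) 0 / k) / max 1 (∑ l, max (x l) 0)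

lemma simplexRetract_continuous {k : ℕ} : Continuous (simplexRetract (k := k)) := by
  refine continuous_pi fun j => ?_
  unfold simplexRetract
  refine Continuous.div (by fun_prop) (by fun_prop) fun x => ?_
  exact (lt_of_lt_of_le one_pos (le_max_left _ _)).ne'

lemma simplexRetract_mem {k : ℕ} (hk : 1 ≤ k) (x : Fin k → ℝ) :
    simplexRetract x ∈ stdSimplex ℝ (Fin k) := by
  constructor
  · intro j
    unfold simplexRetract
    positivity
  · unfold simplexRetract
    have hk' : (k : ℝ) ≠ 0 := by positivity
    rw [← Finset.sum_div, Finset.sum_add_distrib, Finset.sum_const, card_univ, Fintype.card_fin,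
      nsmul_eq_mul, mul_div_cancel₀ _ hk']
    rcases le_total 1 (∑ l, max (x l) 0) with h | h
    · rw [max_eq_right h, max_eq_right (by linarith), add_zero, div_self (by linarith)]
    · rw [max_eq_left h, max_eq_left (by linarith)]; ring

lemma simplexRetract_self {k : ℕ} (x : Fin k → ℝ) (hx : x ∈ stdSimplex ℝ (Fin k)) :
    simplexRetract x = x := by
  funext j
  have h : ∀ l, max (x l) 0 = x l := fun l => max_eq_left (hx.1 l)
  simp [simplexRetract, h, hx.2]

/-- Nash's gain function. -/
noncomputable def gain {n : ℕ} {m : Fin n → ℕ}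
    (u : Fin n → ((i : Fin n) → Fin (m i)) → ℝ)
    (s : (i : Fin n) → Fin (m i) → ℝ) (i : Fin n) (j : Fin (m i)) : ℝ :=
  max (mixedPayoff u i (Function.update s i (Pi.single j 1)) - mixedPayoff u i s) 0

/-- Nash's map. -/
noncomputable def nashMap {n : ℕ} {m : Fin n → ℕ}
    (u : Fin n → ((i : Fin n) → Fin (m i)) → ℝ)
    (s : (i : Fin n) → Fin (m i) → ℝ) (i : Fin n) (j : Fin (m i)) : ℝ :=
  (s i j + gain u s i j) / (1 + ∑ l, gain u s i l)

lemma gain_nonneg {n : ℕ} {m : Fin n → ℕ}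
    (u : Fin n → ((i : Fin n) → Fin (m i)) → ℝ)
    (s : (i : Fin n) → Fin (m i) → ℝ) (i : Fin n) (j : Fin (m i)) : 0 ≤ gain u s i j :=
  le_max_right _ _

lemma nashMap_continuous {n : ℕ} {m : Fin n → ℕ}
    (u : Fin n → ((i : Fin n) → Fin (m i)) → ℝ) : Continuous (nashMap u) := by
  have hg : ∀ i j, Continuous fun s => gain u s i j := by
    intro i j
    unfold gain
    have h1 := payoff_continuous u i
    have h2 : Continuous fun s : (i : Fin n) → Fin (m i) → ℝ =>
        mixedPayoff u i (Function.update s i (Pi.single j 1)) :=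
      h1.comp (continuous_id.update i continuous_const)
    exact (h2.sub h1).max continuous_const
  refine continuous_pi fun i => continuous_pi fun j => ?_
  unfold nashMap
  refine Continuous.div ?_ ?_ ?_
  · have h1 : Continuous fun s : (i : Fin n) → Fin (m i) → ℝ => s i j := by fun_prop
    exact h1.add (hg i j)
  · exact continuous_const.add (continuous_finsetSum _ fun l _ => hg i l)
  · intro s
    have := Finset.sum_nonneg fun l (_ : l ∈ univ) => gain_nonneg u s i l
    linarith

lemma nashMap_mem {n : ℕ} {m : Fin n → ℕ}
    (u : Fin n → ((i : Fin n) → Fin (m i)) → ℝ)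
    (s : (i : Fin n) → Fin (m i) → ℝ) (hs : ∀ i, s i ∈ stdSimplex ℝ (Fin (m i))) (i : Fin n) :
    nashMap u s i ∈ stdSimplex ℝ (Fin (m i)) := by
  have h0 := Finset.sum_nonneg fun l (_ : l ∈ univ) => gain_nonneg u s i l
  constructor
  · intro j
    exact div_nonneg (add_nonneg ((hs i).1 j) (gain_nonneg u s i j)) (by linarith)
  · unfold nashMap
    rw [← Finset.sum_div, Finset.sum_add_distrib, (hs i).2, div_self (by linarith)]

lemma nash_of_fixed {n : ℕ} {m : Fin n → ℕ}
    (u : Fin n → ((i : Fin n) → Fin (m i)) → ℝ)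
    (s : (i : Fin n) → Fin (m i) → ℝ) (hs : ∀ i, s i ∈ stdSimplex ℝ (Fin (m i)))
    (hfix : nashMap u s = s) (i : Fin n) (σ : Fin (m i) → ℝ)
    (hσ : σ ∈ stdSimplex ℝ (Fin (m i))) :
    mixedPayoff u i s ≥ mixedPayoff u i (Function.update s i σ) := by
  set p : Fin (m i) → ℝ := fun j => mixedPayoff u i (Function.update s i (Pi.single j 1)) with hp
  have hself : mixedPayoff u i s = ∑ j, s i j * p j := by
    have := payoff_update u i s (s i)
    rwa [Function.update_eq_self] at this
  have hup : mixedPayoff u i (Function.update s i σ) = ∑ j, σ j * p j := payoff_update u i s σ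
  set c := mixedPayoff u i s with hc
  have h0 := Finset.sum_nonneg fun l (_ : l ∈ univ) => gain_nonneg u s i l
  set S := ∑ l, gain u s i l with hS
  have hfx : ∀ j, s i j * S = gain u s i j := by
    intro j
    have h := congrFun (congrFun hfix i) j
    have h' : (s i j + gain u s i j) / (1 + S) = s i j := h
    rw [div_eq_iff (by linarith)] at h'
    linarith
  -- some used pure strategy has no gain
  obtain ⟨j, hj, hpj⟩ : ∃ j, 0 < s i j ∧ p j ≤ c := by
    by_contra! hcon
    have hle : ∀ j ∈ univ, s i j * c ≤ s i j * p j := by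
      intro j _
      rcases ((hs i).1 j).eq_or_lt with h | h
      · rw [← h]; simp
      · exact mul_le_mul_of_nonneg_left (hcon j h).le h.le
    obtain ⟨j, -, hj⟩ : ∃ j ∈ univ, 0 < s i j := by
      by_contra! h
      have := Finset.sum_nonpos h
      rw [(hs i).2] at this
      linarith
    have hlt := Finset.sum_lt_sum hle ⟨j, mem_univ j, mul_lt_mul_of_pos_left (hcon j hj) hj⟩
    rw [← Finset.sum_mul, (hs i).2, one_mul, ← hself] at hlt
    exact lt_irrefl _ hlt
  have hgj : gain u s i j = 0 := max_eq_right (by linarith)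
  have hS0 : S = 0 := by
    have := hfx j
    rw [hgj] at this
    rcases mul_eq_zero.1 this with h | h
    · linarith
    · exact h
  have hle : ∀ l, p l ≤ c := by
    intro l
    have h1 : gain u s i l = 0 := by rw [← hfx l, hS0, mul_zero]
    have h2 : p l - c ≤ gain u s i l := le_max_left _ _
    linarith
  rw [hup]
  calc ∑ j, σ j * p j ≤ ∑ j, σ j * c :=
        Finset.sum_le_sum fun j _ => mul_le_mul_of_nonneg_left (hle j) (hσ.1 j)
    _ = c := by rw [← Finset.sum_mul, hσ.2, one_mul]

/-- **Nash's equilibrium theorem.** Every finite `n`-player game (each player having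
at least one pure strategy) possesses an equilibrium strategy profile: no player can
increase his expected payoff by unilaterally changing his strategy. -/
theorem nash_equilibrium_exists {n : ℕ} (hn : 1 ≤ n) (m : Fin n → ℕ) (hm : ∀ i, 1 ≤ m i)
    (u : Fin n → ((i : Fin n) → Fin (m i)) → ℝ) :
    ∃ s : (i : Fin n) → Fin (m i) → ℝ,
      (∀ i, s i ∈ stdSimplex ℝ (Fin (m i))) ∧
      ∀ i, ∀ σ ∈ stdSimplex ℝ (Fin (m i)),
        mixedPayoff u i s ≥ mixedPayoff u i (Function.update s i σ) := by
  let E := EuclideanSpace ℝ (Σ i : Fin n, Fin (m i))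
  let r : E → (i : Fin n) → Fin (m i) → ℝ := fun x i => simplexRetract fun j => x ⟨i, j⟩
  have hr : Continuous r := by
    refine continuous_pi fun i => simplexRetract_continuous.comp ?_
    exact continuous_pi fun j => PiLp.continuous_apply 2 _ (⟨i, j⟩ : Σ i : Fin n, Fin (m i))
  have hrm : ∀ x i, r x i ∈ stdSimplex ℝ (Fin (m i)) := fun x i => simplexRetract_mem (hm i) _
  let F : E → E := fun x => WithLp.toLp 2 fun k => nashMap u (r x) k.1 k.2
  have hF : Continuous F := by
    refine (PiLp.continuous_toLp 2 _).comp ?_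
    refine continuous_pi fun k => ?_
    exact (continuous_apply k.2).comp ((continuous_apply k.1).comp ((nashMap_continuous u).comp hr))
  have hFm : ∀ x i, nashMap u (r x) i ∈ stdSimplex ℝ (Fin (m i)) := fun x i =>
    nashMap_mem u _ (hrm x) i
  obtain ⟨x, hx⟩ := bounded_fixed_point F hF
    (Real.sqrt (∑ _k : (Σ i : Fin n, Fin (m i)), (1 : ℝ))) (by
      intro x
      rw [EuclideanSpace.norm_eq]
      refine Real.sqrt_le_sqrt (Finset.sum_le_sum fun k _ => ?_)
      have h0 := (hFm x k.1).1 k.2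
      have h1 : nashMap u (r x) k.1 k.2 ≤ 1 := by
        rw [← (hFm x k.1).2]
        exact Finset.single_le_sum (fun j _ => (hFm x k.1).1 j) (mem_univ k.2)
      change ‖nashMap u (r x) k.1 k.2‖ ^ 2 ≤ 1
      rw [Real.norm_of_nonneg h0]
      nlinarith)
  have hxe : ∀ i j, x ⟨i, j⟩ = nashMap u (r x) i j := by
    intro i j
    conv_lhs => rw [← hx]
  have hrx : r x = nashMap u (r x) := by
    funext i
    have h1 : (fun j => x ⟨i, j⟩) = nashMap u (r x) i := funext fun j => hxe i j
    have h2 : r x i = simplexRetract fun j => x ⟨i, j⟩ := rfl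
    rw [h2, h1]
    exact simplexRetract_self _ (hFm x i)
  exact ⟨r x, hrm x, nash_of_fixed u (r x) (hrm x) hrx.symm⟩
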